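/- (Dwork Lemma with coefficients, for abelian groups.) Let p be a prime, M an abelian group with an external Frobenius φ, and n ≥ 1. Let (b_0, b_1, …, b_{n−1}) be a tuple with b_j ∈ M^{⊗p^j} and σ_j(b_j) = b_j for every 0 ≤ j ≤ n−1. Then (b_0,…,b_{n−1}) lies in the image of the ghost map w : ∏_{i=0}^{n−1} M^{⊗p^i} → ∏_{j=0}^{n−1} M^{⊗p^j} if and only if for every 0 ≤ j < n−1, the element φ_j(b_j) − b_{j+1} lies in the image of the norm map N_{p^{j+1}} = Σ_{s=0}^{p^{j+1}−1} σ_{j+1}^s on M^{⊗p^{j+1}}. -/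

import Mathlib

open scoped TensorProduct

section Digits

/-- Identification of digit tuples `(Fin p)^m` (first digit most significant) with `Fin (p^m)`
via base-`p` digits. -/
def msbEquiv (p m : ℕ) : (Fin m → Fin p) ≃ Fin (p ^ m) :=
  (Equiv.piCongrLeft' (fun _ => Fin p) Fin.revPerm).trans finFunctionFinEquiv

/-- The digit rotation `τ_m : (i_1, …, i_m) ↦ (i_m, i_1, …, i_{m-1})` of digit tuples. -/
def rotPerm (p m : ℕ) [NeZero m] : Equiv.Perm (Fin m → Fin p) :=
  Equiv.piCongrLeft' (fun _ => Fin p) (Equiv.addRight (1 : Fin m))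

/-- The permutation of `Fin (p^m)` corresponding to a permutation of digit tuples. -/
def digitPerm (p m : ℕ) (e : Equiv.Perm (Fin m → Fin p)) : Equiv.Perm (Fin (p ^ m)) :=
  Equiv.permCongr (msbEquiv p m) e

end Digits

noncomputable section Tensor

/-- The `m`-fold tensor power over `ℤ` of an abelian group `A`, indexed by `Fin m`. -/
abbrev Tp (A : Type*) [AddCommGroup A] (m : ℕ) : Type _ := ⨂[ℤ] _ : Fin m, A

/-- The action of a permutation `e` of `Fin m` on the tensor power, by reindexing. -/
def permT (A : Type*) [AddCommGroup A] (m : ℕ) (e : Equiv.Perm (Fin m)) :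
    Tp A m ≃ₗ[ℤ] Tp A m :=
  PiTensorProduct.reindex ℤ (fun _ : Fin m => A) e

/-- The cyclic permutation `σ_m` on the tensor power, induced by reindexing along
`x ↦ x + 1` on `Fin m`, so that `σ(a_1 ⊗ ⋯ ⊗ a_m) = a_m ⊗ a_1 ⊗ ⋯ ⊗ a_{m-1}`. -/
def sigmaT (A : Type*) [AddCommGroup A] (m : ℕ) [NeZero m] : Tp A m ≃ₗ[ℤ] Tp A m :=
  permT A m (Equiv.addRight (1 : Fin m))

/-- The norm (transfer) map `N_m = Σ_{s=0}^{m-1} σ_m^s` on the tensor power. -/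
def normT (A : Type*) [AddCommGroup A] (m : ℕ) [NeZero m] : Tp A m → Tp A m :=
  fun x => ∑ s ∈ Finset.range m, (⇑(sigmaT A m))^[s] x

/-- Identification of tensor powers of equal sizes. -/
def tcast {A : Type*} [AddCommGroup A] {a b : ℕ} (h : a = b) : Tp A a ≃ₗ[ℤ] Tp A b :=
  TensorPower.cast ℤ A h

/-- Flattening of an iterated tensor power: `(A^{⊗N})^{⊗q} ≃ A^{⊗(N·q)}`, grouping
consecutive blocks of length `N`. -/
def flattenE (A : Type*) [AddCommGroup A] (N : ℕ) : (q : ℕ) →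
    (⨂[ℤ] _ : Fin q, Tp A N) ≃ₗ[ℤ] Tp A (N * q)
  | 0 => (PiTensorProduct.isEmptyEquiv (Fin 0)).trans
      (PiTensorProduct.isEmptyEquiv (Fin 0)).symm
  | q + 1 =>
      (TensorPower.mulEquiv (R := ℤ) (M := Tp A N) (n := q) (m := 1)).symm.trans <|
      (TensorProduct.congr (flattenE A N q)
        (PiTensorProduct.subsingletonEquiv (0 : Fin 1))).trans <|
      TensorPower.mulEquiv (R := ℤ) (M := A) (n := N * q) (m := N)

/-- The elementary tensor `c^{⊗B} ∈ A^{⊗(N·B)}` whose `B` consecutive blocks of length `N`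
all equal `c ∈ A^{⊗N}`. -/
def tpow {A : Type*} [AddCommGroup A] {N : ℕ} (c : Tp A N) (B : ℕ) : Tp A (N * B) :=
  flattenE A N B (PiTensorProduct.tprod ℤ (fun _ : Fin B => c))

/-- `c^{⊗B}`, recast to live in `A^{⊗m}` along an identification `N * B = m`. -/
def tpowTo {A : Type*} [AddCommGroup A] {N : ℕ} (c : Tp A N) (B : ℕ) {m : ℕ}
    (h : N * B = m) : Tp A m :=
  tcast (A := A) h (tpow c B)

end Tensor

noncomputable section Frobenius

variable (p : ℕ) [NeZero p] {M : Type*} [AddCommGroup M]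

/-- `φ^{⊗q}` : applies an additive map `φ : M → M^{⊗p}` to each of the `q` tensor factors,
the `p` outputs of each application of `φ` occupying a consecutive block of length `p`. -/
def frobT (φ : M →+ Tp M p) (q : ℕ) : Tp M q →ₗ[ℤ] Tp M (p * q) :=
  (flattenE M p q).toLinearMap ∘ₗ
    PiTensorProduct.map (fun _ : Fin q => φ.toIntLinearMap)

/-- The higher Frobenius `φ_n : M^{⊗p^n} → M^{⊗p^{n+1}}`, the composite of `φ^{⊗p^n}`
(outputs of `φ` in the last base-`p` digit) followed by the action of the digit rotation
`τ_{n+1}`. -/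
def higherFrob (φ : M →+ Tp M p) (n : ℕ) : Tp M (p ^ n) →ₗ[ℤ] Tp M (p ^ (n + 1)) :=
  (permT M (p ^ (n + 1)) (digitPerm p (n + 1) (rotPerm p (n + 1)))).toLinearMap ∘ₗ
    (tcast (A := M) (pow_succ' p n).symm).toLinearMap ∘ₗ frobT p φ (p ^ n)

/-- An external Frobenius on an abelian group `M` (for the prime `p`): an additive map
`φ : M → M^{⊗p}` landing in the `σ_1`-invariants and congruent to `m ↦ m^{⊗p}` modulo the
image of the norm map `N_p = Σ_{s=0}^{p-1} σ_1^s`. -/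
structure ExternalFrobenius (M : Type*) [AddCommGroup M] : Type _ where
  toFun : M →+ Tp M p
  fixed : ∀ m : M, sigmaT M p (toFun m) = toFun m
  congr_pow : ∀ m : M,
    toFun m - PiTensorProduct.tprod ℤ (fun _ : Fin p => m) ∈ Set.range (normT M p)

end Frobenius

/-- The ghost map: its `j`-th component is
`w_j(m_0, …, m_{n-1}) = Σ_{i=0}^{j} Σ_{l=0}^{p^i - 1} σ_j^l (m_i^{⊗p^{j-i}})`. -/
noncomputable def ghost (p : ℕ) [NeZero p] (M : Type*) [AddCommGroup M] (n : ℕ)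
    (m : ∀ i : Fin n, Tp M (p ^ (i : ℕ))) : ∀ j : Fin n, Tp M (p ^ (j : ℕ)) :=
  fun j => ∑ i : Fin n,
    if h : (i : ℕ) ≤ (j : ℕ) then
      ∑ l ∈ Finset.range (p ^ (i : ℕ)),
        (⇑(sigmaT M (p ^ (j : ℕ))))^[l]
          (tpowTo (m i) (p ^ ((j : ℕ) - (i : ℕ)))
            (by rw [← pow_add, Nat.add_sub_cancel' h]))
    else 0

/-! ### Twisted cyclic shifts -/

/-- The cyclic shift `z ↦ (e (z_{P-1}), z_0, …, z_{P-2})` of tuples, twisted by `e` at the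
wrap-around. -/
def twistShift {α : Type*} (P : ℕ) [NeZero P] (e : α → α) (z : Fin P → α) : Fin P → α :=
  fun n => if (n : ℕ) = 0 then e (z ⟨P - 1, Nat.sub_one_lt (NeZero.ne P)⟩)
    else z ⟨n - 1, (Nat.sub_le _ _).trans_lt n.2⟩

theorem twistShift_apply {α : Type*} (P : ℕ) [NeZero P] (e : α → α) (z : Fin P → α) (n : Fin P) :
    twistShift P e z n = if (n : ℕ) = 0 then e (z ((Equiv.addRight (1 : Fin P)).symm n))
      else z ((Equiv.addRight (1 : Fin P)).symm n) := by
  have hn := n.2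
  have hv : ∀ k : Fin P, ((k : ℕ) + 1) % P = n → (Equiv.addRight (1 : Fin P)).symm n = k := by
    intro k hk
    rw [(Equiv.symm_apply_eq _).2]
    ext
    simp [Fin.val_add, hk]
  simp only [twistShift]
  split_ifs with h
  · rw [hv]
    rw [Nat.sub_add_cancel (NeZero.pos P), Nat.mod_self, h]
  · rw [hv]
    rw [Nat.sub_add_cancel (Nat.pos_of_ne_zero h), Nat.mod_eq_of_lt hn]

theorem twistShift_iterate {α : Type*} (P : ℕ) [NeZero P] (e : α → α) (z : Fin P → α)
    {t : ℕ} (ht : t ≤ P) (n : Fin P) :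
    (twistShift P e)^[t] z n =
      if h : t ≤ n then z ⟨n - t, (Nat.sub_le _ _).trans_lt n.2⟩
      else e (z ⟨n + P - t, by omega⟩) := by
  induction t generalizing n with
  | zero => simp
  | succ t ih =>
    rw [Function.iterate_succ_apply', twistShift]
    have hn := n.2
    split_ifs with h0 h1 h1
    · omega
    · rw [ih (by omega), dif_pos (show t ≤ P - 1 by omega)]
      congr 3
      dsimp only
      omega
    · rw [ih (by omega), dif_pos (show t ≤ (n : ℕ) - 1 by omega)]
      congr 2
      dsimp only
      omega
    · rw [ih (by omega), dif_neg (show ¬ t ≤ (n : ℕ) - 1 by omega)]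
      congr 3
      dsimp only
      omega

theorem twistShift_iterate_self {α : Type*} (P : ℕ) [NeZero P] (e : α → α) (z : Fin P → α) :
    (twistShift P e)^[P] z = e ∘ z := by
  funext n
  rw [twistShift_iterate P e z le_rfl, dif_neg (by omega)]
  simp

theorem twistShift_comp {α β : Type*} (P : ℕ) [NeZero P] {e : α → α} {e' : β → β} {g : α → β}
    (h : ∀ a, g (e a) = e' (g a)) (z : Fin P → α) :
    twistShift P e' (g ∘ z) = g ∘ twistShift P e z := by
  funext n
  simp only [twistShift, Function.comp]
  split_ifs <;> simp [h]

/-- Reading off block number and position inside the block intertwines shifts by whole blocks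
with shifts of block numbers. -/
theorem twistShift_blocks {α β γ : Type*} {N Q P : ℕ} [NeZero P] [NeZero Q] (hP : N * Q = P)
    (e : β → β) (E : γ → γ) (U : α → Fin N → β → γ)
    (hU : ∀ a r b, U a r (e b) = E (U a r b)) (c : Fin Q → α) (f : Fin P → β) :
    (twistShift P E)^[N] (fun n : Fin P => U (c ⟨n / N, Nat.div_lt_of_lt_mul (hP ▸ n.2)⟩)
        ⟨n % N, Nat.mod_lt _ (Nat.pos_of_ne_zero (by rintro rfl; have := n.2; omega))⟩ (f n)) =
      fun n : Fin P => U (twistShift Q id c ⟨n / N, Nat.div_lt_of_lt_mul (hP ▸ n.2)⟩)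
        ⟨n % N, Nat.mod_lt _ (Nat.pos_of_ne_zero (by rintro rfl; have := n.2; omega))⟩
        ((twistShift P e)^[N] f n) := by
  have hQ0 := NeZero.pos Q
  have hNP : N ≤ P := hP ▸ Nat.le_mul_of_pos_right N hQ0
  funext n
  have hN : 0 < N := Nat.pos_of_ne_zero (by rintro rfl; have := n.2; omega)
  rw [twistShift_iterate P E _ hNP, twistShift_iterate P e _ hNP]
  by_cases h : N ≤ (n : ℕ)
  · have h1 : ((n : ℕ) - N) / N = n / N - 1 := by
      simpa using Nat.sub_mul_div (n : ℕ) N 1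
    have h2 : ((n : ℕ) - N) % N = n % N := (Nat.mod_eq_sub_mod h).symm
    have h3 : (n : ℕ) / N ≠ 0 := (Nat.div_pos h hN).ne'
    simp only [dif_pos h, twistShift, h3, if_false, h1, h2]
  · have h0 : (n : ℕ) / N = 0 := Nat.div_eq_of_lt (not_le.1 h)
    have h4 : (n : ℕ) + P - N = n + N * (Q - 1) := by
      rw [Nat.mul_sub, hP]
      omega
    have h1 : ((n : ℕ) + P - N) / N = Q - 1 := by
      rw [h4, Nat.add_mul_div_left _ _ hN, h0, zero_add]
    have h2 : ((n : ℕ) + P - N) % N = n % N := by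
      rw [h4, Nat.add_mul_mod_self_left]
    simp only [dif_neg h, twistShift, h0, if_true, h1, h2, id, hU]

/-! ### Sums over free orbits -/

/-- The sum of an equivariant function over a finite set on which a map `T` of order `p^(k+1)`
acts freely lies in the image of the norm map. -/
theorem exists_sum_eq_norm_of_free {α G : Type*} [AddCommGroup G] (S : G →+ G) (T : α → α)
    {p k : ℕ} (hp : p.Prime) (F : α → G) (hF : ∀ x, F (T x) = S (F x))
    (s : Finset α) (hs : ∀ x ∈ s, T x ∈ s) (hper : ∀ x ∈ s, T^[p ^ (k + 1)] x = x)
    (hfree : ∀ x ∈ s, T^[p ^ k] x ≠ x) :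
    ∃ e : G, ∑ x ∈ s, F x = ∑ t ∈ Finset.range (p ^ (k + 1)), S^[t] e := by
  classical
  have hpos : 0 < p ^ (k + 1) := pow_pos hp.pos _
  have hFt : ∀ t x, F (T^[t] x) = S^[t] (F x) := by
    intro t
    induction t with
    | zero => simp
    | succ t ih => intro x; rw [Function.iterate_succ_apply', hF, ih, Function.iterate_succ_apply']
  induction s using Finset.strongInduction with
  | H s ih =>
    obtain rfl | ⟨x, hx⟩ := s.eq_empty_or_nonempty
    · exact ⟨0, by simp⟩
    have hit : ∀ t, T^[t] x ∈ s := by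
      intro t
      induction t with
      | zero => exact hx
      | succ t iht => rw [Function.iterate_succ_apply']; exact hs _ iht
    have hmin : Function.minimalPeriod T x = p ^ (k + 1) :=
      Function.minimalPeriod_eq_prime_pow (hp := ⟨hp⟩) (hfree x hx) (hper x hx)
    have hO : (Finset.range (p ^ (k + 1))).image (fun t => T^[t] x) ⊆ s := by
      intro y hy
      obtain ⟨t, -, rfl⟩ := Finset.mem_image.1 hy
      exact hit t
    have hmem : ∀ t, T^[t] x ∈ (Finset.range (p ^ (k + 1))).image (fun t => T^[t] x) := by
      intro t
      refine Finset.mem_image.2 ⟨t % p ^ (k + 1), Finset.mem_range.2 (Nat.mod_lt _ hpos), ?_⟩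
      exact (show Function.IsPeriodicPt T _ x from hper x hx).iterate_mod_apply t
    obtain ⟨e, he⟩ := ih (s \ (Finset.range (p ^ (k + 1))).image (fun t => T^[t] x))
      (Finset.sdiff_ssubset hO ⟨x, hmem 0⟩)
      (by
        intro y hy
        obtain ⟨hys, hyO⟩ := Finset.mem_sdiff.1 hy
        refine Finset.mem_sdiff.2 ⟨hs y hys, fun hTy => hyO ?_⟩
        obtain ⟨t, -, ht⟩ := Finset.mem_image.1 hTy
        have hy : y = T^[p ^ (k + 1) - 1 + t] x := by
          rw [Function.iterate_add_apply, ht, ← Function.iterate_succ_apply, Nat.succ_eq_add_one,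
            Nat.sub_add_cancel hpos, hper y hys]
        exact hy ▸ hmem _)
      (fun y hy => hper y (Finset.mem_sdiff.1 hy).1)
      (fun y hy => hfree y (Finset.mem_sdiff.1 hy).1)
    refine ⟨e + F x, ?_⟩
    rw [← Finset.sum_sdiff hO, he, Finset.sum_image]
    · rw [← Finset.sum_add_distrib]
      exact Finset.sum_congr rfl fun t _ => by rw [hFt, iterate_map_add]
    · intro a ha b hb hab
      simp only [Finset.coe_range, Set.mem_Iio] at ha hb
      exact Function.iterate_injOn_Iio_minimalPeriod (by rwa [hmin]) (by rwa [hmin]) hab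

/-- If `T` has order dividing `p^(k+1)`, then the sum of an equivariant function is, modulo the
image of the norm map, its sum over the fixed points of `T^(p^k)`. -/
theorem exists_sum_eq_norm_add_sum_fixed {α G : Type*} [Fintype α] [DecidableEq α]
    [AddCommGroup G] (S : G →+ G) (T : α → α) {p k : ℕ} (hp : p.Prime) (F : α → G)
    (hF : ∀ x, F (T x) = S (F x)) (hper : ∀ x, T^[p ^ (k + 1)] x = x) :
    ∃ e : G, ∑ x, F x = ∑ t ∈ Finset.range (p ^ (k + 1)), S^[t] e +
      ∑ x with T^[p ^ k] x = x, F x := by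
  have hpos : 0 < p ^ (k + 1) := pow_pos hp.pos _
  have hinj : Function.Injective T := by
    refine Function.LeftInverse.injective (g := T^[p ^ (k + 1) - 1]) fun x => ?_
    rw [← Function.iterate_succ_apply, Nat.succ_eq_add_one, Nat.sub_add_cancel hpos, hper]
  obtain ⟨e, he⟩ := exists_sum_eq_norm_of_free S T hp F hF
    (Finset.univ.filter fun x => ¬ T^[p ^ k] x = x)
    (by
      intro x hx
      rw [Finset.mem_filter] at hx ⊢
      refine ⟨Finset.mem_univ _, fun h => hx.2 (hinj ?_)⟩
      rw [← Function.iterate_succ_apply' T, Function.iterate_succ_apply, h])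
    (fun x _ => hper x) (fun x hx => (Finset.mem_filter.1 hx).2)
  exact ⟨e, by rw [← he, add_comm, Finset.sum_filter_add_sum_filter_not]⟩

theorem sum_range_iterate_mul {G : Type*} [AddCommGroup G] (S : G →+ G) (a b : ℕ) (x : G) :
    ∑ l ∈ Finset.range a, S^[l] (∑ t ∈ Finset.range b, (S^[a])^[t] x) =
      ∑ s ∈ Finset.range (a * b), S^[s] x := by
  induction b with
  | zero => simp
  | succ b ih =>
    rw [Nat.mul_succ, Finset.sum_range_add _ (a * b), ← ih, ← Finset.sum_add_distrib]
    refine Finset.sum_congr rfl fun l _ => ?_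
    rw [Finset.sum_range_succ, iterate_map_add, ← Function.iterate_mul,
      ← Function.iterate_add_apply, Nat.add_comm]

/-! ### Tensor powers of pure tensors -/

section TensorPowers

open PiTensorProduct

section

variable {A : Type*} [AddCommGroup A]

theorem permT_tprod (m : ℕ) (e : Equiv.Perm (Fin m)) (v : Fin m → A) :
    permT A m e (tprod ℤ v) = tprod ℤ fun n => v (e.symm n) :=
  reindex_tprod e v

theorem tcast_tprod {a b : ℕ} (h : a = b) (v : Fin a → A) :
    tcast (A := A) h (tprod ℤ v) = tprod ℤ fun n => v (Fin.cast h.symm n) :=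
  TensorPower.cast_tprod ℤ A h v

theorem sigmaT_tprod (m : ℕ) [NeZero m] (v : Fin m → A) :
    sigmaT A m (tprod ℤ v) = tprod ℤ (twistShift m id v) := by
  rw [sigmaT, permT_tprod]
  congr 1
  funext n
  simp [twistShift_apply]

theorem sigmaT_iterate_tprod (m : ℕ) [NeZero m] (t : ℕ) (v : Fin m → A) :
    (sigmaT A m)^[t] (tprod ℤ v) = tprod ℤ ((twistShift m id)^[t] v) := by
  induction t with
  | zero => rfl
  | succ t ih => rw [Function.iterate_succ_apply', ih, sigmaT_tprod, Function.iterate_succ_apply']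

theorem flattenE_tprod (N q : ℕ) (v : Fin q → Fin N → A) :
    flattenE A N q (tprod ℤ fun b => tprod ℤ (v b)) =
      tprod ℤ fun n : Fin (N * q) => v ⟨n / N, Nat.div_lt_of_lt_mul n.2⟩
        ⟨n % N, Nat.mod_lt _ (Nat.pos_of_ne_zero (by rintro rfl; have := n.2; omega))⟩ := by
  induction q with
  | zero =>
    rw [flattenE, LinearEquiv.trans_apply, isEmptyEquiv_apply_tprod]
    rw [LinearEquiv.symm_apply_eq, isEmptyEquiv_apply_tprod]
  | succ q ih =>
    have h1 : tprod ℤ (fun b : Fin (q + 1) => tprod ℤ (v b)) =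
        TensorPower.mulEquiv ((tprod ℤ fun b : Fin q => tprod ℤ (v b.castSucc)) ⊗ₜ[ℤ]
          (tprod ℤ fun _ : Fin 1 => tprod ℤ (v (Fin.last q)))) := by
      refine Eq.trans ?_ (TensorPower.tprod_mul_tprod ℤ _ _).symm
      congr 1
      funext b
      refine Fin.lastCases ?_ (fun b => ?_) b
      · exact (Fin.append_right (fun b : Fin q => tprod ℤ (v b.castSucc))
          (fun _ : Fin 1 => tprod ℤ (v (Fin.last q))) 0).symm
      · exact (Fin.append_left (fun b : Fin q => tprod ℤ (v b.castSucc))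
          (fun _ : Fin 1 => tprod ℤ (v (Fin.last q))) b).symm
    rw [h1, flattenE, LinearEquiv.trans_apply, LinearEquiv.symm_apply_apply,
      LinearEquiv.trans_apply, TensorProduct.congr_tmul, ih, subsingletonEquiv_apply_tprod]
    refine (TensorPower.tprod_mul_tprod ℤ _ _).trans ?_
    congr 1
    funext n
    refine Fin.addCases (fun n => ?_) (fun n => ?_) n
    · rw [Fin.append_left]
      rfl
    · rw [Fin.append_right]
      have hN : 0 < N := n.pos
      have hd : (N * q + (n : ℕ)) / N = q := by
        rw [Nat.mul_add_div hN, Nat.div_eq_of_lt n.2, add_zero]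
      have hm : (N * q + (n : ℕ)) % N = n := by
        rw [Nat.mul_add_mod, Nat.mod_eq_of_lt n.2]
      simp only [Fin.val_natAdd, hd, hm]
      rfl

theorem exists_eq_sum_tprod {ι : Type*} [Nonempty ι] (a : ⨂[ℤ] _ : ι, A) :
    ∃ (C : ℕ) (x : Fin C → ι → A), a = ∑ c, tprod ℤ (x c) := by
  classical
  induction a using PiTensorProduct.induction_on with
  | smul_tprod r f =>
    let i : ι := Classical.arbitrary ι
    refine ⟨1, fun _ => Function.update f i (r • f i), ?_⟩
    simp [MultilinearMap.map_update_smul]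
  | add x y hx hy =>
    obtain ⟨C, x, rfl⟩ := hx
    obtain ⟨D, y, rfl⟩ := hy
    exact ⟨C + D, Fin.append x y, by simp [Fin.sum_univ_add]⟩

theorem multilinearMap_ext_tprod {ι κ B : Type*} [Fintype ι] [AddCommGroup B] [Nonempty κ]
    {f g : MultilinearMap ℤ (fun _ : ι => ⨂[ℤ] _ : κ, A) B}
    (h : ∀ v : ι → κ → A, f (fun i => tprod ℤ (v i)) = g fun i => tprod ℤ (v i)) : f = g := by
  classical
  ext z
  choose C x hx using fun i => exists_eq_sum_tprod (z i)
  obtain rfl : z = fun i => ∑ c, tprod ℤ (x i c) := funext hx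
  rw [MultilinearMap.map_sum, MultilinearMap.map_sum]
  exact Finset.sum_congr rfl fun r _ => h _

theorem tpowTo_sum_tprod {N B m C : ℕ} (h : N * B = m) (x : Fin C → Fin N → A) :
    tpowTo (∑ c, tprod ℤ (x c)) B h =
      ∑ c : Fin B → Fin C, tprod ℤ fun n : Fin m =>
        x (c ⟨n / N, Nat.div_lt_of_lt_mul (h ▸ n.2)⟩)
          ⟨n % N, Nat.mod_lt _ (Nat.pos_of_ne_zero (by rintro rfl; have := n.2; omega))⟩ := by
  rw [tpowTo, tpow, MultilinearMap.map_sum, map_sum, map_sum]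
  refine Finset.sum_congr rfl fun c _ => ?_
  rw [flattenE_tprod N B fun b => x (c b), tcast_tprod]
  rfl

end

/-! ### The higher Frobenius -/

theorem msbEquiv_val (p m : ℕ) (y : Fin m → Fin p) :
    (msbEquiv p m y : ℕ) = ∑ i : Fin m, (y i.rev : ℕ) * p ^ (i : ℕ) := by
  simp [msbEquiv, Equiv.piCongrLeft']

theorem rotPerm_apply (p m : ℕ) [NeZero m] (y : Fin m → Fin p) (i : Fin m) :
    rotPerm p m y (i + 1) = y i := by
  simp [rotPerm, Equiv.piCongrLeft']

theorem digitPerm_rotPerm_val (p j : ℕ) (N : Fin (p ^ (j + 1))) :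
    (digitPerm p (j + 1) (rotPerm p (j + 1)) N : ℕ) = N / p + N % p * p ^ j := by
  obtain ⟨y, rfl⟩ := (msbEquiv p (j + 1)).surjective N
  rw [digitPerm, Equiv.permCongr_apply, Equiv.symm_apply_apply, msbEquiv_val, msbEquiv_val,
    Fin.sum_univ_castSucc, Fin.sum_univ_succ]
  have hlt := (y (Fin.last j)).2
  have h0 : rotPerm p (j + 1) y (Fin.last j).rev = y (Fin.last j) := by
    rw [← rotPerm_apply p (j + 1) y (Fin.last j)]
    simp
  have h1 : ∀ i : Fin j, rotPerm p (j + 1) y i.castSucc.rev = y i.succ.rev := by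
    intro i
    rw [← rotPerm_apply p (j + 1) y i.succ.rev, Fin.rev_castSucc, Fin.rev_succ,
      Fin.coeSucc_eq_succ]
  have h2 : ∑ i : Fin j, (y i.succ.rev : ℕ) * p ^ (i.succ : ℕ) =
      p * ∑ i : Fin j, (y i.succ.rev : ℕ) * p ^ (i : ℕ) := by
    rw [Finset.mul_sum]
    exact Finset.sum_congr rfl fun i _ => by rw [Fin.val_succ, pow_succ]; ring
  simp only [h0, h1, h2, Fin.rev_zero, Fin.val_zero, pow_zero, mul_one, Fin.val_castSucc,
    Fin.val_last]
  rw [Nat.add_mul_div_left _ _ (by omega), Nat.add_mul_mod_self_left, Nat.div_eq_of_lt hlt,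
    Nat.mod_eq_of_lt hlt, zero_add]

section

variable (M : Type*) [AddCommGroup M] (p j : ℕ)

/-- The tensor in `M^{⊗p^(j+1)}` obtained from `p^j` tensors in `M^{⊗p}` by placing the `r`-th
factor of the `q`-th tensor at position `r * p^j + q`. -/
noncomputable def interleave :
    MultilinearMap ℤ (fun _ : Fin (p ^ j) => Tp M p) (Tp M (p ^ (j + 1))) :=
  ((permT M (p ^ (j + 1)) (digitPerm p (j + 1) (rotPerm p (j + 1)))).toLinearMap ∘ₗ
    (tcast (A := M) (pow_succ' p j).symm).toLinearMap ∘ₗ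
      (flattenE M p (p ^ j)).toLinearMap).compMultilinearMap (tprod ℤ)

theorem higherFrob_tprod (φ : M →+ Tp M p) (v : Fin (p ^ j) → M) :
    higherFrob p φ j (tprod ℤ v) = interleave M p j fun n => φ (v n) := by
  simp [higherFrob, frobT, interleave]

variable [NeZero p]

theorem interleave_tprod (w : Fin (p ^ j) → Fin p → M) :
    interleave M p j (fun n => tprod ℤ (w n)) = tprod ℤ fun N : Fin (p ^ (j + 1)) =>
      w ⟨N % p ^ j, Nat.mod_lt _ (NeZero.pos _)⟩
        ⟨N / p ^ j, Nat.div_lt_of_lt_mul (pow_succ p j ▸ N.2)⟩ := by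
  have h : interleave M p j (fun n => tprod ℤ (w n)) =
      permT M (p ^ (j + 1)) (digitPerm p (j + 1) (rotPerm p (j + 1)))
        (tcast (A := M) (pow_succ' p j).symm
          (flattenE M p (p ^ j) (tprod ℤ fun n => tprod ℤ (w n)))) := rfl
  rw [h, flattenE_tprod, tcast_tprod, permT_tprod]
  congr 1
  funext N
  have hp := NeZero.pos p
  have hP : 0 < p ^ j := NeZero.pos _
  have hd : (N : ℕ) / p ^ j < p := Nat.div_lt_of_lt_mul (pow_succ p j ▸ N.2)
  have hm : (N : ℕ) % p ^ j < p ^ j := Nat.mod_lt _ hP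
  have hlt : (N : ℕ) / p ^ j + p * (N % p ^ j) < p ^ (j + 1) := by
    calc (N : ℕ) / p ^ j + p * (N % p ^ j) < p + p * (N % p ^ j) := by omega
      _ = p * (N % p ^ j + 1) := by ring
      _ ≤ p * p ^ j := Nat.mul_le_mul_left _ hm
      _ = p ^ (j + 1) := (pow_succ' p j).symm
  have he : (digitPerm p (j + 1) (rotPerm p (j + 1))).symm N =
      ⟨(N : ℕ) / p ^ j + p * (N % p ^ j), hlt⟩ := by
    rw [Equiv.symm_apply_eq]
    ext
    rw [digitPerm_rotPerm_val]
    simp only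
    rw [Nat.add_mul_div_left _ _ hp, Nat.add_mul_mod_self_left, Nat.div_eq_of_lt hd,
      Nat.mod_eq_of_lt hd, zero_add, Nat.mod_add_div']
  have h1 : ((N : ℕ) / p ^ j + p * (N % p ^ j)) / p = N % p ^ j := by
    rw [Nat.add_mul_div_left _ _ hp, Nat.div_eq_of_lt hd, zero_add]
  have h2 : ((N : ℕ) / p ^ j + p * (N % p ^ j)) % p = N / p ^ j := by
    rw [Nat.add_mul_mod_self_left, Nat.mod_eq_of_lt hd]
  simp only [he, Fin.val_cast, h1, h2]

theorem twistShift_interleave {α : Type*} (P : ℕ) [NeZero P] {R : ℕ} (hR : P * p = R) [NeZero R]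
    (w : Fin P → Fin p → α) :
    twistShift R id (fun N : Fin R => w ⟨N % P, Nat.mod_lt _ (NeZero.pos _)⟩
        ⟨N / P, Nat.div_lt_of_lt_mul (hR ▸ N.2)⟩) =
      fun N : Fin R => twistShift P (twistShift p id) w ⟨N % P, Nat.mod_lt _ (NeZero.pos _)⟩
        ⟨N / P, Nat.div_lt_of_lt_mul (hR ▸ N.2)⟩ := by
  subst hR
  funext N
  have hP : 0 < P := NeZero.pos _
  have hp : 0 < p := NeZero.pos _
  obtain ⟨N, hN⟩ := N
  have hpred : ∀ t, 0 < t → (P * t - 1) / P = t - 1 ∧ (P * t - 1) % P = P - 1 := by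
    intro t ht
    obtain ⟨t, rfl⟩ := Nat.exists_eq_add_of_lt ht
    have : P * (0 + t + 1) - 1 = P - 1 + P * t := by
      rw [zero_add, Nat.mul_succ]
      omega
    rw [this, Nat.add_mul_div_left _ _ hP, Nat.add_mul_mod_self_left,
      Nat.div_eq_of_lt (by omega), Nat.mod_eq_of_lt (by omega)]
    omega
  by_cases h0 : N % P = 0
  · obtain ⟨t, rfl⟩ := Nat.dvd_of_mod_eq_zero h0
    have ht : P * t / P = t := Nat.mul_div_cancel_left _ hP
    rcases Nat.eq_zero_or_pos t with rfl | htpos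
    · simp [twistShift, hpred p hp]
    · have hne : P * t ≠ 0 := (Nat.mul_pos hP htpos).ne'
      simp [twistShift, hpred t htpos, ht, hne, htpos.ne']
  · have hne : N ≠ 0 := by
      rintro rfl
      exact h0 (Nat.zero_mod _)
    have hdm := Nat.mod_add_div N P
    have hr := Nat.mod_lt N hP
    have h1 : N - 1 = (N % P - 1) + P * (N / P) := by omega
    have h2 : (N - 1) / P = N / P := by
      rw [h1, Nat.add_mul_div_left _ _ hP, Nat.div_eq_of_lt (by omega), zero_add]
    have h3 : (N - 1) % P = N % P - 1 := by
      rw [h1, Nat.add_mul_mod_self_left, Nat.mod_eq_of_lt (by omega)]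
    simp [twistShift, h0, hne, h2, h3]

theorem sigmaT_interleave (z : Fin (p ^ j) → Tp M p) :
    sigmaT M (p ^ (j + 1)) (interleave M p j z) =
      interleave M p j (twistShift (p ^ j) (sigmaT M p) z) := by
  let e : Equiv.Perm (Fin (p ^ j)) := (Equiv.addRight (1 : Fin (p ^ j))).symm
  let L : Fin (p ^ j) → (Tp M p →ₗ[ℤ] Tp M p) :=
    fun n => if (n : ℕ) = 0 then (sigmaT M p).toLinearMap else LinearMap.id
  have hL : ∀ z : Fin (p ^ j) → Tp M p,
      (((interleave M p j).compLinearMap L).domDomCongr e) z =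
        interleave M p j (twistShift (p ^ j) (sigmaT M p) z) := by
    intro z
    refine congrArg (interleave M p j) (funext fun n => ?_)
    rw [twistShift_apply]
    change L n (z (e n)) = _
    by_cases h : (n : ℕ) = 0
    · simp only [L, h, if_true, e]
      rfl
    · simp only [L, h, if_false, e]
      rfl
  have key : (sigmaT M (p ^ (j + 1))).toLinearMap.compMultilinearMap (interleave M p j) =
      ((interleave M p j).compLinearMap L).domDomCongr e := by
    refine multilinearMap_ext_tprod fun w => ?_
    rw [hL, LinearMap.compMultilinearMap_apply, interleave_tprod M p j w]
    have := twistShift_comp (p ^ j) (e := twistShift p id) (e' := sigmaT M p) (g := tprod ℤ)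
      (fun v => (sigmaT_tprod p v).symm) w
    refine (sigmaT_tprod _ _).trans ?_
    rw [twistShift_interleave p (p ^ j) (pow_succ p j).symm]
    refine Eq.trans ?_ (congrArg (interleave M p j) this).symm
    exact (interleave_tprod M p j _).symm
  rw [← hL, ← key]
  rfl

end

/-- The norm map as a homomorphism. -/
noncomputable def normTHom (A : Type*) [AddCommGroup A] (m : ℕ) [NeZero m] : Tp A m →+ Tp A m :=
  AddMonoidHom.mk' (normT A m) fun x y => by
    simp [normT, iterate_map_add, Finset.sum_add_distrib]

section

variable {p : ℕ} [NeZero p] {M : Type*} [AddCommGroup M]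

theorem higherFrob_sigmaT (φ : ExternalFrobenius p M) (j : ℕ) (x : Tp M (p ^ j)) :
    higherFrob p φ.toFun j (sigmaT M (p ^ j) x) =
      sigmaT M (p ^ (j + 1)) (higherFrob p φ.toFun j x) := by
  have key : higherFrob p φ.toFun j ∘ₗ (sigmaT M (p ^ j)).toLinearMap =
      (sigmaT M (p ^ (j + 1))).toLinearMap ∘ₗ higherFrob p φ.toFun j := by
    ext v
    change higherFrob p φ.toFun j (sigmaT M (p ^ j) (tprod ℤ v)) =
      sigmaT M (p ^ (j + 1)) (higherFrob p φ.toFun j (tprod ℤ v))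
    rw [sigmaT_tprod, higherFrob_tprod, higherFrob_tprod, sigmaT_interleave]
    exact congrArg _ (twistShift_comp (p ^ j) (e := id) (g := φ.toFun)
      (fun m => (φ.fixed m).symm) v).symm
  exact LinearMap.congr_fun key x

/-- Tuples on `Fin Q'` fixed under the shift by a divisor `Q` of `Q'` are the `Q`-periodic ones. -/
theorem twistShift_iterate_eq_self_iff {α : Type*} {Q Q' : ℕ} [NeZero Q] [NeZero Q']
    (hQ : Q ∣ Q') (c : Fin Q' → α) :
    (twistShift Q' id)^[Q] c = c ↔
      ∀ n : Fin Q', c ⟨n % Q, (Nat.mod_lt _ (NeZero.pos Q)).trans_le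
        (Nat.le_of_dvd (NeZero.pos Q') hQ)⟩ = c n := by
  have hle : Q ≤ Q' := Nat.le_of_dvd (NeZero.pos Q') hQ
  have hQ0 : 0 < Q := NeZero.pos Q
  constructor
  · intro h
    rintro ⟨n, hn⟩
    induction n using Nat.strong_induction_on with
    | _ n ih =>
      rcases Nat.lt_or_ge n Q with hlt | hge
      · simp [Nat.mod_eq_of_lt hlt]
      · have h1 := congrFun h ⟨n, hn⟩
        rw [twistShift_iterate Q' id c hle, dif_pos (by exact hge)] at h1
        have h2 := ih (n - Q) (by omega) (by omega)
        simp only [← Nat.mod_eq_sub_mod hge] at h2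
        exact h2.trans h1
  · intro h
    funext n
    have hn := n.2
    rw [twistShift_iterate Q' id c hle]
    split_ifs with h1
    · rw [← h ⟨n - Q, _⟩, ← h n]
      simp only [← Nat.mod_eq_sub_mod h1]
    · rw [id, ← h ⟨n + Q' - Q, _⟩, ← h n]
      obtain ⟨d, rfl⟩ := hQ
      obtain ⟨d, rfl⟩ : ∃ d', d = d' + 1 := Nat.exists_eq_add_one.2 (Nat.pos_of_ne_zero (by
        rintro rfl
        omega))
      have : (n : ℕ) + Q * (d + 1) - Q = n + Q * d := by
        have := Nat.mul_add_one Q d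
        omega
      simp only [this, Nat.add_mul_mod_self_left]

/-- The higher Frobenius of a tensor power is congruent to the next tensor power, modulo the
image of the norm map of the group generated by the shift of blocks. -/
theorem exists_higherFrob_tpowTo_sub_eq (hp : p.Prime) (φ : ExternalFrobenius p M) {i k k' j : ℕ}
    (hk : k' = k + 1) (h1 : p ^ i * p ^ k = p ^ j) (h2 : p ^ i * p ^ k' = p ^ (j + 1))
    (a : Tp M (p ^ i)) :
    ∃ e, higherFrob p φ.toFun j (tpowTo a (p ^ k) h1) - tpowTo a (p ^ k') h2 =
      ∑ t ∈ Finset.range (p ^ (k + 1)), ((sigmaT M (p ^ (j + 1)))^[p ^ i])^[t] e := by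
  classical
  subst hk
  obtain ⟨C, x, rfl⟩ := exists_eq_sum_tprod a
  choose y hy using φ.congr_pow
  let U : M → Option (Fin p) → Tp M p := fun m o =>
    o.elim (tprod ℤ fun _ => m) fun r => (sigmaT M p)^[(r : ℕ)] (y m)
  let rot : Option (Fin p) → Option (Fin p) := Option.map (· + 1)
  have hper : ∀ v : Tp M p, (sigmaT M p)^[p] v = v := by
    intro v
    induction v using PiTensorProduct.induction_on with
    | smul_tprod r f =>
      have := sigmaT_iterate_tprod p p f
      rw [twistShift_iterate_self] at this
      rw [← LinearEquiv.coe_toLinearMap, ← Module.End.coe_pow, map_smul, Module.End.coe_pow,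
        LinearEquiv.coe_toLinearMap, this]
      rfl
    | add v w hv hw => rw [iterate_map_add, hv, hw]
  have hU : ∀ m o, U m (rot o) = sigmaT M p (U m o) := by
    rintro m (_ | r)
    · refine ((sigmaT_tprod p _).trans (congrArg _ ?_)).symm
      funext n
      simp [twistShift]
    · change (sigmaT M p)^[((r + 1 : Fin p) : ℕ)] (y m) =
        sigmaT M p ((sigmaT M p)^[(r : ℕ)] (y m))
      rw [← Function.iterate_succ_apply' (sigmaT M p), Fin.val_add, Fin.val_one', Nat.add_mod_mod]
      exact (show Function.IsPeriodicPt (sigmaT M p) p (y m) from hper _).iterate_mod_apply _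
  have hφ : ∀ m, φ.toFun m = ∑ o, U m o := by
    intro m
    rw [Fintype.sum_option, ← sub_eq_iff_eq_add']
    exact (hy m).symm.trans (Finset.sum_range _)
  let S : Tp M (p ^ (j + 1)) →+ Tp M (p ^ (j + 1)) :=
    AddMonoidHom.mk' ((sigmaT M (p ^ (j + 1)))^[p ^ i]) fun v w => iterate_map_add _ _ v w
  have hS : ∀ v, S v = (sigmaT M (p ^ (j + 1)))^[p ^ i] v := fun _ => rfl
  have hSz : ∀ (t : ℕ) z, (sigmaT M (p ^ (j + 1)))^[t] (interleave M p j z) =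
      interleave M p j ((twistShift (p ^ j) (sigmaT M p))^[t] z) := by
    intro t z
    induction t with
    | zero => rfl
    | succ t ih =>
      rw [Function.iterate_succ_apply', ih, sigmaT_interleave, Function.iterate_succ_apply']
  let F : (Fin (p ^ k) → Fin C) × (Fin (p ^ j) → Option (Fin p)) → Tp M (p ^ (j + 1)) :=
    fun cf => interleave M p j fun n =>
      U (x (cf.1 ⟨n / p ^ i, Nat.div_lt_of_lt_mul (n.2.trans_eq h1.symm)⟩)
        ⟨n % p ^ i, Nat.mod_lt _ (NeZero.pos _)⟩) (cf.2 n)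
  let F' : (Fin (p ^ (k + 1)) → Fin C) → Tp M (p ^ (j + 1)) :=
    fun c => tprod ℤ fun n : Fin (p ^ (j + 1)) =>
      x (c ⟨n / p ^ i, Nat.div_lt_of_lt_mul (n.2.trans_eq h2.symm)⟩)
        ⟨n % p ^ i, Nat.mod_lt _ (NeZero.pos _)⟩
  let T : (Fin (p ^ k) → Fin C) × (Fin (p ^ j) → Option (Fin p)) →
      (Fin (p ^ k) → Fin C) × (Fin (p ^ j) → Option (Fin p)) :=
    Prod.map (twistShift (p ^ k) id) ((twistShift (p ^ j) rot)^[p ^ i])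
  let T' : (Fin (p ^ (k + 1)) → Fin C) → (Fin (p ^ (k + 1)) → Fin C) :=
    twistShift (p ^ (k + 1)) id
  have hF : ∀ cf, F (T cf) = S (F cf) := by
    intro cf
    rw [hS, hSz]
    exact congrArg (interleave M p j) (twistShift_blocks h1 rot (sigmaT M p)
      (fun c r o => U (x c r) o) (fun c r o => hU _ o) cf.1 cf.2).symm
  have hF' : ∀ c, F' (T' c) = S (F' c) := by
    intro c
    refine Eq.trans ?_ (sigmaT_iterate_tprod _ _ _).symm
    exact congrArg (PiTensorProduct.tprod ℤ) (twistShift_blocks h2 id id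
      (fun c r (_ : Unit) => x c r) (fun _ _ _ => rfl) c fun _ => ()).symm
  have hTk : ∀ cf, T^[p ^ k] cf = (cf.1, rot ∘ cf.2) := by
    intro cf
    rw [Prod.map_iterate, Prod.map_apply, twistShift_iterate_self, ← Function.iterate_mul, h1,
      twistShift_iterate_self]
    rfl
  have hrot : rot^[p] = id := by
    have h : p • (1 : Fin p) = 0 := by simpa using card_nsmul_eq_zero (x := (1 : Fin p))
    funext o
    cases o with
    | none => exact Function.iterate_fixed rfl p
    | some r =>
      have h' : ∀ t : ℕ, rot^[t] (some r) = some ((· + 1)^[t] r) := by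
        intro t
        induction t with
        | zero => rfl
        | succ t ih => rw [Function.iterate_succ_apply', ih, Function.iterate_succ_apply']; rfl
      rw [h', add_right_iterate_apply, h, add_zero, id]
  have hTper : ∀ cf, T^[p ^ (k + 1)] cf = cf := by
    intro cf
    have h : ∀ t : ℕ, (T^[p ^ k])^[t] cf = (cf.1, rot^[t] ∘ cf.2) := by
      intro t
      induction t with
      | zero => rfl
      | succ t ih => rw [Function.iterate_succ_apply', ih, hTk, Function.iterate_succ']; rfl
    rw [pow_succ, Function.iterate_mul, h, hrot]
    rfl
  have hrot_ne : ∀ r, rot (some r) ≠ some r := by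
    intro r h
    have := congrArg Fin.val (Option.some.inj h)
    have hr := r.2
    have hp2 := hp.two_le
    rw [Fin.val_add, Fin.val_one', Nat.add_mod_mod] at this
    rcases Nat.lt_or_ge (r + 1) p with h' | h'
    · rw [Nat.mod_eq_of_lt h'] at this
      omega
    · rw [show (r : ℕ) + 1 = p by omega, Nat.mod_self] at this
      omega
  have hT'per : ∀ c, T'^[p ^ (k + 1)] c = c := fun c => twistShift_iterate_self _ _ c
  have hfix : ∀ cf, T^[p ^ k] cf = cf ↔ cf.2 = fun _ => none := by
    intro cf
    rw [hTk, Prod.ext_iff]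
    simp only [true_and]
    refine ⟨fun h => funext fun n => ?_, fun h => by rw [h]; rfl⟩
    have hn := congrFun h n
    cases ho : cf.2 n with
    | none => rfl
    | some r =>
      rw [Function.comp, ho] at hn
      exact absurd hn (hrot_ne r)
  have hdvd : p ^ k ∣ p ^ (k + 1) := pow_dvd_pow p k.le_succ
  have hle : p ^ k ≤ p ^ (k + 1) := Nat.le_of_dvd (NeZero.pos _) hdvd
  have hfix' := fun c : Fin (p ^ (k + 1)) → Fin C =>
    twistShift_iterate_eq_self_iff hdvd c
  have hfixed : ∑ cf with T^[p ^ k] cf = cf, F cf = ∑ c with T'^[p ^ k] c = c, F' c := by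
    refine Finset.sum_bij'
      (fun cf _ n => cf.1 ⟨n % p ^ k, Nat.mod_lt _ (NeZero.pos _)⟩)
      (fun c _ => (fun n => c (Fin.castLE hle n), fun _ => none)) ?_ ?_ ?_ ?_ ?_
    · intro cf _
      simp only [Finset.mem_filter, Finset.mem_univ, true_and]
      exact (hfix' _).2 fun n => by simp only [Nat.mod_mod]
    · intro c _
      simp only [Finset.mem_filter, Finset.mem_univ, true_and]
      exact (hfix _).2 rfl
    · intro cf hcf
      rw [Finset.mem_filter] at hcf
      refine Prod.ext (funext fun n => ?_) ((hfix _).1 hcf.2).symm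
      simp [Nat.mod_eq_of_lt n.2]
    · intro c hc
      rw [Finset.mem_filter] at hc
      exact funext fun n => (hfix' c).1 hc.2 n
    · intro cf hcf
      rw [Finset.mem_filter] at hcf
      simp only [F, F', U, (hfix _).1 hcf.2, Option.elim]
      refine (interleave_tprod M p j _).trans
        (congrArg (PiTensorProduct.tprod ℤ) (funext fun n => ?_))
      have h3 : (n : ℕ) % p ^ j % p ^ i = n % p ^ i := by rw [← h1, Nat.mod_mul_right_mod]
      have h4 : (n : ℕ) % p ^ j / p ^ i = n / p ^ i % p ^ k := by
        rw [← h1, Nat.mod_mul_right_div_self]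
      simp only [h3, h4]
  have hsum : higherFrob p φ.toFun j (tpowTo (∑ c, tprod ℤ (x c)) (p ^ k) h1) = ∑ cf, F cf := by
    rw [tpowTo_sum_tprod, map_sum, Fintype.sum_prod_type]
    refine Finset.sum_congr rfl fun c _ => ?_
    rw [higherFrob_tprod]
    simp only [hφ]
    rw [MultilinearMap.map_sum]
  have hsum' : tpowTo (∑ c, tprod ℤ (x c)) (p ^ (k + 1)) h2 = ∑ c, F' c := tpowTo_sum_tprod _ _
  obtain ⟨e, he⟩ := exists_sum_eq_norm_add_sum_fixed S T hp F hF hTper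
  obtain ⟨e', he'⟩ := exists_sum_eq_norm_add_sum_fixed S T' hp F' hF' hT'per
  refine ⟨e - e', ?_⟩
  rw [hsum, hsum', he, he', hfixed, add_sub_add_right_eq_sub, ← Finset.sum_sub_distrib]
  exact Finset.sum_congr rfl fun t _ => (iterate_map_sub S t e e').symm

theorem tpowTo_one {m B : ℕ} [NeZero m] (a : Tp M m) (hB : B = 1) (h : m * B = m) :
    tpowTo a B h = a := by
  subst hB
  obtain ⟨C, x, rfl⟩ := exists_eq_sum_tprod a
  rw [tpowTo_sum_tprod, ← (Equiv.funUnique (Fin 1) (Fin C)).symm.sum_comp]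
  refine Finset.sum_congr rfl fun c _ => congrArg _ (funext fun n => ?_)
  simp [Equiv.funUnique, uniqueElim_const, Nat.mod_eq_of_lt n.2]

/-- The higher Frobenius carries a summand of a ghost component to the corresponding summand of
the next ghost component, modulo the image of the norm map. -/
theorem higherFrob_sum_tpowTo_sub_mem (hp : p.Prime) (φ : ExternalFrobenius p M) {i k k' j : ℕ}
    (hk : k' = k + 1) (h1 : p ^ i * p ^ k = p ^ j) (h2 : p ^ i * p ^ k' = p ^ (j + 1))
    (a : Tp M (p ^ i)) :
    higherFrob p φ.toFun j
        (∑ l ∈ Finset.range (p ^ i), (sigmaT M (p ^ j))^[l] (tpowTo a (p ^ k) h1)) -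
      ∑ l ∈ Finset.range (p ^ i), (sigmaT M (p ^ (j + 1)))^[l] (tpowTo a (p ^ k') h2) ∈
        (normTHom M (p ^ (j + 1))).range := by
  have hcomm : ∀ (l : ℕ) x, higherFrob p φ.toFun j ((sigmaT M (p ^ j))^[l] x) =
      (sigmaT M (p ^ (j + 1)))^[l] (higherFrob p φ.toFun j x) := fun l x =>
    (show Function.Semiconj (higherFrob p φ.toFun j) (sigmaT M (p ^ j)) (sigmaT M (p ^ (j + 1)))
      from higherFrob_sigmaT φ j).iterate_right l x
  obtain ⟨e, he⟩ := exists_higherFrob_tpowTo_sub_eq hp φ hk h1 h2 a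
  refine ⟨e, ?_⟩
  rw [map_sum, ← Finset.sum_sub_distrib]
  have := sum_range_iterate_mul (sigmaT M (p ^ (j + 1))).toAddEquiv.toAddMonoidHom
    (p ^ i) (p ^ (k + 1)) e
  subst hk
  rw [h2] at this
  refine this.symm.trans (Finset.sum_congr rfl fun l _ => ?_)
  rw [hcomm, ← iterate_map_sub, he]
  rfl

theorem higherFrob_ghost_sub_mem (hp : p.Prime) (φ : ExternalFrobenius p M) {n : ℕ}
    (m : ∀ i : Fin n, Tp M (p ^ (i : ℕ))) (j : ℕ) (hj : j + 1 < n) :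
    higherFrob p φ.toFun j (ghost p M n m ⟨j, Nat.lt_of_succ_lt hj⟩) -
      ghost p M n m ⟨j + 1, hj⟩ ∈ (normTHom M (p ^ (j + 1))).range := by
  rw [ghost, ghost, map_sum, ← Finset.sum_sub_distrib]
  refine sum_mem fun i _ => ?_
  rcases Nat.lt_trichotomy i (j + 1) with h | h | h
  · rw [dif_pos (Nat.le_of_lt_succ h), dif_pos h.le]
    exact higherFrob_sum_tpowTo_sub_mem hp φ (Nat.succ_sub (Nat.le_of_lt_succ h)) _ _ _
  · obtain rfl : i = ⟨j + 1, hj⟩ := Fin.ext h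
    rw [dif_neg (by simp), dif_pos le_rfl, map_zero, zero_sub, neg_mem_iff]
    refine ⟨m ⟨j + 1, hj⟩, ?_⟩
    change ∑ l ∈ Finset.range (p ^ (j + 1)), _ = _
    refine Finset.sum_congr rfl fun l _ => ?_
    rw [tpowTo_one _ (by simp)]
  · rw [dif_neg (by simp; omega), dif_neg (by simp; omega), map_zero, sub_zero]
    exact zero_mem _

theorem ghost_update_of_lt {n : ℕ} (m : ∀ i : Fin n, Tp M (p ^ (i : ℕ))) {j t : Fin n} (h : j < t)
    (a : Tp M (p ^ (t : ℕ))) : ghost p M n (Function.update m t a) j = ghost p M n m j := by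
  refine Finset.sum_congr rfl fun i _ => ?_
  by_cases hi : (i : ℕ) ≤ j
  · have hne : i ≠ t := by
      rintro rfl
      exact absurd h (not_lt.2 hi)
    simp only [Function.update_of_ne hne]
  · rw [dif_neg hi, dif_neg hi]

theorem ghost_update_self {n : ℕ} (m : ∀ i : Fin n, Tp M (p ^ (i : ℕ))) (t : Fin n)
    (a : Tp M (p ^ (t : ℕ))) :
    ghost p M n (Function.update m t (m t + a)) t =
      ghost p M n m t + normT M (p ^ (t : ℕ)) a := by
  rw [← sub_eq_iff_eq_add', ghost, ghost, ← Finset.sum_sub_distrib, Finset.sum_eq_single t]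
  · rw [dif_pos le_rfl, dif_pos le_rfl, ← Finset.sum_sub_distrib]
    refine Finset.sum_congr rfl fun l _ => ?_
    rw [tpowTo_one _ (by simp), tpowTo_one _ (by simp), Function.update_self, iterate_map_add,
      add_sub_cancel_left]
  · intro i _ hi
    simp only [Function.update_of_ne hi, sub_self]
  · exact fun h => absurd (Finset.mem_univ t) h

end

end TensorPowers

/-- Dwork lemma with coefficients, for abelian groups: let `p` be a prime,
`M` an abelian group with an external Frobenius `φ`, and `n ≥ 1`.  A tuple
`(b_0, …, b_{n-1})` with `b_j ∈ M^{⊗p^j}` and `σ_j(b_j) = b_j` lies in the image of the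
ghost map if and only if for every `0 ≤ j < n - 1` the element `φ_j(b_j) − b_{j+1}` lies in
the image of the norm map `N_{p^{j+1}}` on `M^{⊗p^{j+1}}`. -/
theorem statement10 (p : ℕ) [NeZero p] (hp : p.Prime) (M : Type*) [AddCommGroup M]
    (φ : ExternalFrobenius p M) (n : ℕ) (hn : 1 ≤ n)
    (b : ∀ j : Fin n, Tp M (p ^ (j : ℕ)))
    (hb : ∀ j : Fin n, sigmaT M (p ^ (j : ℕ)) (b j) = b j) :
    (∃ m : ∀ i : Fin n, Tp M (p ^ (i : ℕ)), ghost p M n m = b)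
      ↔ ∀ (j : ℕ) (hj : j + 1 < n),
          higherFrob p φ.toFun j (b ⟨j, Nat.lt_of_succ_lt hj⟩) - b ⟨j + 1, hj⟩
            ∈ Set.range (normT M (p ^ (j + 1))) := by
  constructor
  · rintro ⟨m, rfl⟩ j hj
    exact higherFrob_ghost_sub_mem hp φ m j hj
  · intro h
    have key : ∀ t ≤ n, ∃ m : ∀ i : Fin n, Tp M (p ^ (i : ℕ)),
        ∀ j : Fin n, (j : ℕ) < t → ghost p M n m j = b j := by
      intro t
      induction t with
      | zero => exact fun _ => ⟨0, fun j hj => absurd hj (Nat.not_lt_zero _)⟩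
      | succ t ih =>
        intro ht
        obtain ⟨m, hm⟩ := ih (Nat.le_of_succ_le ht)
        have hmem : b ⟨t, ht⟩ - ghost p M n m ⟨t, ht⟩ ∈ (normTHom M (p ^ t)).range := by
          cases t with
          | zero =>
            refine ⟨b ⟨0, ht⟩ - ghost p M n m ⟨0, ht⟩, ?_⟩
            have hr : Finset.range (p ^ 0) = {0} := by simp
            exact (Finset.sum_congr hr fun _ _ => rfl).trans (Finset.sum_singleton _ _)
          | succ j =>
            have h1 := higherFrob_ghost_sub_mem hp φ m j ht
            rw [hm ⟨j, Nat.lt_of_succ_lt ht⟩ (Nat.lt_succ_self j)] at h1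
            have h2 : _ ∈ (normTHom M (p ^ (j + 1))).range := h j ht
            simpa using sub_mem h1 h2
        obtain ⟨e, he⟩ := hmem
        refine ⟨Function.update m ⟨t, ht⟩ (m ⟨t, ht⟩ + e), fun j hj => ?_⟩
        rcases Nat.lt_succ_iff_lt_or_eq.1 hj with hlt | heq
        · rw [ghost_update_of_lt m (show j < ⟨t, ht⟩ from hlt), hm j hlt]
        · obtain rfl : j = ⟨t, ht⟩ := Fin.ext heq
          rw [ghost_update_self]
          exact (congrArg _ he).trans (add_sub_cancel _ _)
    obtain ⟨m, hm⟩ := key n le_rfl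
    exact ⟨m, funext fun j => hm j j.2⟩
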